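/- Let d ∈ N and s > d/2. Then a_{n+1}(I_d : H^{s,2}(T^d) → L∞(T^d)) ≤ √(2d/(2s−d)) · (32e/d)^{s/2} · n^{1/2 − s/d} for all n ≥ 9^d e^{d/2}, and a_n(I_d : H^{s,2}(T^d) → L∞(T^d)) ≥ √(4d/(4s−d)) · (1/(e(d+2)))^{s/2} · n^{1/2 − s/d} for all n ≥ 11^d e^{d/2}. -/

import Mathlib

open MeasureTheory Filter
open scoped ENNReal NNReal

noncomputable section

/-- The index lattice `ℤ^d`. -/
abbrev ZLat (d : ℕ) := Fin d → ℤ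

instance fact_two_pi_pos : Fact (0 < 2 * Real.pi) := ⟨by positivity⟩

/-- The `d`-dimensional torus `𝕋^d = [0,2π]^d` with endpoints identified. -/
abbrev Torus (d : ℕ) := Fin d → AddCircle (2 * Real.pi)

/-- The normalized Lebesgue measure `(2π)^{-d} dx` on the `d`-torus. -/
def torusMeasure (d : ℕ) : Measure (Torus d) :=
  ((ENNReal.ofReal (2 * Real.pi))⁻¹) ^ d • Measure.pi fun _ => volume

/-- The character `e^{i k·x}` on the `d`-torus. -/
def torusChar {d : ℕ} (k : ZLat d) (x : Torus d) : ℂ :=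
  ∏ j, fourier (k j) (x j)

/-- The `k`-th Fourier coefficient `f̂(k) = (2π)^{-d} ∫_{𝕋^d} f(x) e^{-i k·x} dx`. -/
def fourierCoef {d : ℕ} (f : Torus d → ℂ) (k : ZLat d) : ℂ :=
  ∫ x, (starRingEnd ℂ) (torusChar k x) * f x ∂(torusMeasure d)

/-- The `n`-th approximation number of a bounded linear operator `T`:
`a_n(T) = inf {‖T - A‖ : rank A < n}`. -/
def approxNum {X Y : Type*} [NormedAddCommGroup X] [NormedSpace ℂ X]
    [NormedAddCommGroup Y] [NormedSpace ℂ Y] (T : X →L[ℂ] Y) (n : ℕ) : ℝ :=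
  sInf {c : ℝ | ∃ A : X →L[ℂ] Y,
    Module.rank ℂ (LinearMap.range (A : X →ₗ[ℂ] Y)) < n ∧ c = ‖T - A‖}

/-- `ℓ²(ℤ^d)`; an isometric model of the Hilbert space `F_d(w)` via `f ↦ (w(k)·f̂(k))_k`.
Under this identification the embedding `I_d : F_d(w) → G` is characterized by the
property that the function `T c` has Fourier coefficients `c(k)/w(k)`. -/
abbrev ellTwo (d : ℕ) := lp (fun _ : ZLat d => ℂ) 2

/-- `ℓ¹(ℤ^d)`; an isometric model of the Wiener algebra `A(𝕋^d)` via `f ↦ (f̂(k))_k`. -/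
abbrev ellOne (d : ℕ) := lp (fun _ : ZLat d => ℂ) 1

/-- `ℓ^∞(ℤ^d)`; an isometric model of the space `ℬ(𝕋^d)` of distributions with bounded
Fourier coefficients. -/
abbrev ellInfty (d : ℕ) := lp (fun _ : ZLat d => ℂ) ⊤

/-- The weight `w_{s,r}(k) = (1 + ∑_j |k_j|^r)^{s/r}` of the isotropic Sobolev space
`H^{s,r}(𝕋^d) = F_d(w_{s,r})`. -/
def wIso (d : ℕ) (s r : ℝ) (k : ZLat d) : ℝ := (1 + ∑ j, |(k j : ℝ)| ^ r) ^ (s / r)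

/-- The squared Euclidean norm of a lattice point. -/
def latSqNorm {d : ℕ} (k : ZLat d) : ℕ := ∑ j, (k j).natAbs ^ 2

theorem natAbs_le_latSqNorm {d : ℕ} (k : ZLat d) (j : Fin d) : (k j).natAbs ≤ latSqNorm k := by
  calc (k j).natAbs ≤ (k j).natAbs ^ 2 := Nat.le_self_pow two_ne_zero _
    _ ≤ latSqNorm k :=
      Finset.single_le_sum (f := fun j => (k j).natAbs ^ 2) (fun _ _ => Nat.zero_le _)
        (Finset.mem_univ j)

theorem finite_latSqNorm_le (d H : ℕ) : {k : ZLat d | latSqNorm k ≤ H}.Finite := by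
  refine (Fintype.piFinset fun _ : Fin d => Finset.Icc (-(H : ℤ)) H).finite_toSet.subset ?_
  intro k hk
  simp only [Finset.mem_coe, Fintype.mem_piFinset, Finset.mem_Icc]
  intro j
  have h1 := natAbs_le_latSqNorm k j
  have h2 : latSqNorm k ≤ H := hk
  omega

/-- A function to `ℕ` with finite sublevel sets is compatible with an injective ranking. -/
theorem exists_injective_rank {X : Type*} [Countable X] (h : X → ℕ)
    (hf : ∀ n, {x | h x ≤ n}.Finite) :
    ∃ r : X → ℕ, Function.Injective r ∧
      ∀ x, {y | h y < h x}.ncard ≤ r x ∧ r x < {y | h y ≤ h x}.ncard := by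
  obtain ⟨c, hc⟩ := exists_injective_nat X
  let L : X → Set X := fun x => {y | h y < h x ∨ h y = h x ∧ c y < c x}
  have hL : ∀ x, L x ⊆ {y | h y ≤ h x} := by
    rintro x y (hy | hy)
    · exact hy.le
    · exact hy.1.le
  have hmono : ∀ x y, (h x < h y ∨ h x = h y ∧ c x < c y) → (L x).ncard < (L y).ncard := by
    intro x y hxy
    refine Set.ncard_lt_ncard ((Set.ssubset_iff_of_subset ?_).2 ⟨x, hxy, ?_⟩)
      ((hf (h y)).subset (hL y))
    · intro z hz
      simp only [L, Set.mem_ofPred_eq] at hz ⊢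
      omega
    · simp [L]
  refine ⟨fun x => (L x).ncard, fun x y hxy => ?_, fun x => ⟨?_, ?_⟩⟩
  · by_contra hne
    have hcne : c x ≠ c y := fun e => hne (hc e)
    have : (h x < h y ∨ h x = h y ∧ c x < c y) ∨ (h y < h x ∨ h y = h x ∧ c y < c x) := by omega
    rcases this with h1 | h1
    · exact (hmono _ _ h1).ne hxy
    · exact (hmono _ _ h1).ne hxy.symm
  · exact Set.ncard_le_ncard (fun y hy => Or.inl hy) ((hf (h x)).subset (hL x))
  · exact Set.ncard_lt_ncard ((Set.ssubset_iff_of_subset (hL x)).2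
      ⟨x, le_refl (h x), by simp [L]⟩) (hf (h x))

theorem sum_exp_neg_mul_abs_le {u : ℝ} (hu : 0 < u) (H : ℕ) :
    ∑ m ∈ Finset.Icc (-(H : ℤ)) H, Real.exp (-(u * |(m : ℝ)|)) ≤ 1 + 2 / u := by
  have key : ∑ m ∈ Finset.Icc (-(H : ℤ)) H, Real.exp (-(u * |(m : ℝ)|)) ≤
      1 + 2 / u * (1 - Real.exp (-(u * H))) := by
    induction H with
    | zero => simp
    | succ H ih =>
      have hset : Finset.Icc (-((H + 1 : ℕ) : ℤ)) ((H + 1 : ℕ) : ℤ) =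
          insert ((H : ℤ) + 1) (insert (-((H : ℤ) + 1)) (Finset.Icc (-(H : ℤ)) H)) := by
        ext m
        simp only [Finset.mem_Icc, Finset.mem_insert]
        omega
      rw [hset, Finset.sum_insert (by simp only [Finset.mem_Icc, Finset.mem_insert]; omega),
        Finset.sum_insert (by simp only [Finset.mem_Icc]; omega)]
      have habs : |((H : ℝ) + 1)| = (H : ℝ) + 1 := abs_of_nonneg (by positivity)
      push_cast
      rw [abs_neg, habs]
      have hsplit : Real.exp (-(u * H)) = Real.exp (-(u * (H + 1))) * Real.exp u := by
        rw [← Real.exp_add]; ring_nf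
      have hstep : 2 * Real.exp (-(u * (H + 1))) ≤
          2 / u * (Real.exp (-(u * H)) - Real.exp (-(u * (H + 1)))) := by
        rw [hsplit, div_mul_eq_mul_div, le_div_iff₀ hu]
        nlinarith [Real.add_one_le_exp u, Real.exp_pos (-(u * (H + 1)))]
      linarith
  refine key.trans ?_
  have : 2 / u * (1 - Real.exp (-(u * H))) ≤ 2 / u * 1 :=
    mul_le_mul_of_nonneg_left (by linarith [Real.exp_pos (-(u * H))]) (by positivity)
  linarith

theorem card_le_of_latSqNorm_le {d : ℕ} (hd : 0 < d) (H : ℕ) :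
    ({k : ZLat d | latSqNorm k ≤ H}.ncard : ℝ) ≤
      (Real.exp 1 * (1 + 2 * √((1 + H) / d))) ^ d := by
  have hd' : (0 : ℝ) < d := by exact_mod_cast hd
  set ρ : ℝ := 1 + H with hρ
  have hρ0 : 0 < ρ := by positivity
  set u : ℝ := √(d / ρ) with hu
  have hu0 : 0 < u := Real.sqrt_pos.2 (by positivity)
  have hu2 : u ^ 2 = d / ρ := Real.sq_sqrt (by positivity)
  have huinv : 2 / u = 2 * √(ρ / d) := by
    rw [hu, div_eq_mul_inv, ← Real.sqrt_inv, inv_div]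
  have hfin := finite_latSqNorm_le d H
  rw [Set.ncard_eq_toFinset_card _ hfin]
  have hsub : hfin.toFinset ⊆ Fintype.piFinset fun _ : Fin d => Finset.Icc (-(H : ℤ)) H := by
    intro k hk
    simp only [Fintype.mem_piFinset, Finset.mem_Icc]
    intro j
    have h1 := natAbs_le_latSqNorm k j
    have h2 : latSqNorm k ≤ H := by simpa using hk
    omega
  have hone : ∀ k ∈ hfin.toFinset,
      (1 : ℝ) ≤ Real.exp 1 ^ d * ∏ j, Real.exp (-(u * |((k j : ℤ) : ℝ)|)) := by
    intro k hk
    have h2 : latSqNorm k ≤ H := by simpa using hk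
    have h3 : ∑ j, |((k j : ℤ) : ℝ)| ^ 2 ≤ ρ := by
      have : ((latSqNorm k : ℕ) : ℝ) = ∑ j, |((k j : ℤ) : ℝ)| ^ 2 := by
        simp [latSqNorm, Nat.cast_natAbs]
      rw [← this, hρ]
      have : (latSqNorm k : ℝ) ≤ H := by exact_mod_cast h2
      linarith
    have h4 : (∑ j, u * |((k j : ℤ) : ℝ)|) ≤ d := by
      have : ∀ j : Fin d, u * |((k j : ℤ) : ℝ)| ≤ 1 / 2 + u ^ 2 / 2 * |((k j : ℤ) : ℝ)| ^ 2 := by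
        intro j
        nlinarith [sq_nonneg (u * |((k j : ℤ) : ℝ)| - 1)]
      calc _ ≤ ∑ j : Fin d, (1 / 2 + u ^ 2 / 2 * |((k j : ℤ) : ℝ)| ^ 2) :=
            Finset.sum_le_sum fun j _ => this j
        _ = d / 2 + u ^ 2 / 2 * ∑ j, |((k j : ℤ) : ℝ)| ^ 2 := by
            rw [Finset.sum_add_distrib, ← Finset.mul_sum]; simp; ring
        _ ≤ d / 2 + u ^ 2 / 2 * ρ := by gcongr
        _ = d := by rw [hu2]; field_simp; ring
    rw [← Real.exp_sum, ← Real.exp_nat_mul, ← Real.exp_add, Finset.sum_neg_distrib]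
    exact Real.one_le_exp (by linarith)
  calc (hfin.toFinset.card : ℝ) = ∑ k ∈ hfin.toFinset, (1 : ℝ) := by simp
    _ ≤ ∑ k ∈ hfin.toFinset, Real.exp 1 ^ d * ∏ j, Real.exp (-(u * |((k j : ℤ) : ℝ)|)) :=
        Finset.sum_le_sum hone
    _ ≤ ∑ k ∈ Fintype.piFinset fun _ : Fin d => Finset.Icc (-(H : ℤ)) H,
          Real.exp 1 ^ d * ∏ j, Real.exp (-(u * |((k j : ℤ) : ℝ)|)) :=
        Finset.sum_le_sum_of_subset_of_nonneg hsub fun _ _ _ => by positivity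
    _ = Real.exp 1 ^ d *
          (∑ m ∈ Finset.Icc (-(H : ℤ)) H, Real.exp (-(u * |(m : ℝ)|))) ^ d := by
        rw [← Finset.mul_sum, ← Finset.prod_univ_sum (fun _ : Fin d => Finset.Icc (-(H : ℤ)) H)
          (fun _ m => Real.exp (-(u * |(m : ℝ)|)))]
        simp
    _ ≤ Real.exp 1 ^ d * (1 + 2 / u) ^ d := by
        gcongr
        exact sum_exp_neg_mul_abs_le hu0 H
    _ = _ := by rw [huinv, mul_pow]

theorem pow_le_ncard_latSqNorm_lt {d m H : ℕ} (h : d * m ^ 2 < H) :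
    (2 * m + 1) ^ d ≤ {k : ZLat d | latSqNorm k < H}.ncard := by
  have hcard : (Fintype.piFinset fun _ : Fin d => Finset.Icc (-(m : ℤ)) m).card =
      (2 * m + 1) ^ d := by
    rw [Fintype.card_piFinset_const, Int.card_Icc]
    congr 1
    omega
  rw [← hcard, ← Set.ncard_coe_finset]
  have hfin : {k : ZLat d | latSqNorm k < H}.Finite :=
    (finite_latSqNorm_le d H).subset fun k (hk : latSqNorm k < H) => show latSqNorm k ≤ H from hk.le
  refine Set.ncard_le_ncard ?_ hfin
  intro k hk
  simp only [Finset.mem_coe, Fintype.mem_piFinset, Finset.mem_Icc] at hk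
  refine lt_of_le_of_lt ?_ h
  calc latSqNorm k ≤ ∑ _j : Fin d, m ^ 2 := Finset.sum_le_sum fun j _ =>
        Nat.pow_le_pow_left (by have := hk j; omega) 2
    _ = d * m ^ 2 := by simp

theorem wIso_two {d : ℕ} (s : ℝ) (k : ZLat d) :
    wIso d s 2 k = (1 + (latSqNorm k : ℝ)) ^ (s / 2) := by
  simp [wIso, latSqNorm, Nat.cast_natAbs]

theorem wIso_two_pos {d : ℕ} (s : ℝ) (k : ZLat d) : 0 < wIso d s 2 k := by
  rw [wIso_two]; positivity

theorem inv_wIso_two_sq {d : ℕ} (s : ℝ) (k : ZLat d) :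
    ((wIso d s 2 k)⁻¹) ^ 2 = (1 + (latSqNorm k : ℝ)) ^ (-s) := by
  rw [wIso_two, ← Real.rpow_neg (by positivity), ← Real.rpow_mul_natCast (by positivity)]
  congr 1
  push_cast
  ring

/-- An upper bound for `J` in terms of the squared radius of a ball with `J` lattice points. -/
theorem rpow_le_of_le_ncard {d : ℕ} (hd : 0 < d) {H : ℕ} {J : ℝ}
    (hJ : (9 : ℝ) ^ d * Real.exp ((d : ℝ) / 2) ≤ J)
    (hJH : J ≤ {k : ZLat d | latSqNorm k ≤ H}.ncard) :
    J ^ (2 / (d : ℝ)) ≤ 32 * Real.exp 1 / d * (1 + H) := by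
  have hd' : (0 : ℝ) < d := by exact_mod_cast hd
  set x := √((1 + H) / (d : ℝ)) with hx
  have hx0 : 0 ≤ x := Real.sqrt_nonneg _
  have hx2 : x ^ 2 = (1 + H) / d := Real.sq_sqrt (by positivity)
  have hJ0 : 0 < J := lt_of_lt_of_le (by positivity) hJ
  set g := Real.exp (1 / 2) with hg
  have hg0 : 0 < g := Real.exp_pos _
  have hg2 : g ^ 2 = Real.exp 1 := by rw [hg, ← Real.exp_nat_mul]; norm_num
  have hge : g < 1.65 := by
    have := Real.exp_one_lt_d9
    nlinarith
  have hle := hJH.trans (card_le_of_latSqNorm_le hd H)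
  rw [← hx] at hle
  have h9 : (9 * g) ^ d ≤ (Real.exp 1 * (1 + 2 * x)) ^ d := by
    refine le_trans (le_of_eq ?_) (hJ.trans hle)
    rw [mul_pow, hg, ← Real.exp_nat_mul]
    ring_nf
  have h9' : 9 * g ≤ Real.exp 1 * (1 + 2 * x) :=
    le_of_pow_le_pow_left₀ hd.ne' (by positivity) h9
  have h9x : 9 ≤ g * (1 + 2 * x) := by
    rw [← hg2] at h9'
    nlinarith
  have hx2' : 2 ≤ x := by nlinarith
  have hroot : J ^ (2 / (d : ℝ)) ≤ (Real.exp 1 * (1 + 2 * x)) ^ 2 := by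
    calc J ^ (2 / (d : ℝ)) ≤ ((Real.exp 1 * (1 + 2 * x)) ^ d) ^ (2 / (d : ℝ)) :=
          Real.rpow_le_rpow hJ0.le hle (by positivity)
      _ = (Real.exp 1 * (1 + 2 * x)) ^ 2 := by
          rw [← Real.rpow_natCast_mul (by positivity)]
          rw [mul_div_cancel₀ _ hd'.ne']
          norm_num
  refine hroot.trans ?_
  have h32 : 32 * Real.exp 1 / d * (1 + H) = 32 * Real.exp 1 * x ^ 2 := by rw [hx2]; ring
  rw [h32, mul_pow]
  have h1 : (1 + 2 * x) ^ 2 ≤ (5 / 2 * x) ^ 2 := by gcongr; linarith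
  have he : Real.exp 1 < 2.72 := by linarith [Real.exp_one_lt_d9]
  calc Real.exp 1 ^ 2 * (1 + 2 * x) ^ 2 ≤ Real.exp 1 ^ 2 * (5 / 2 * x) ^ 2 := by gcongr
    _ = Real.exp 1 * (Real.exp 1 * (25 / 4)) * x ^ 2 := by ring
    _ ≤ Real.exp 1 * 32 * x ^ 2 := by gcongr; linarith
    _ = _ := by ring

theorem inv_wIso_sq_le {d : ℕ} (hd : 0 < d) {s : ℝ} (hs : 0 < s) (k : ZLat d) {J : ℝ}
    (hJ : (9 : ℝ) ^ d * Real.exp ((d : ℝ) / 2) ≤ J)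
    (hJk : J ≤ {l : ZLat d | latSqNorm l ≤ latSqNorm k}.ncard) :
    ((wIso d s 2 k)⁻¹) ^ 2 ≤ (32 * Real.exp 1 / d) ^ s * J ^ (-(2 * s / d)) := by
  have hd' : (0 : ℝ) < d := by exact_mod_cast hd
  have hJ0 : 0 < J := lt_of_lt_of_le (by positivity) hJ
  have h := rpow_le_of_le_ncard hd hJ hJk
  rw [inv_wIso_two_sq, Real.rpow_neg (by positivity), Real.rpow_neg hJ0.le, ← div_eq_mul_inv,
    inv_le_iff_one_le_mul₀ (by positivity), div_mul_eq_mul_div, one_le_div (by positivity),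
    ← Real.mul_rpow (by positivity) (by positivity)]
  calc J ^ (2 * s / d) = (J ^ (2 / (d : ℝ))) ^ s := by rw [← Real.rpow_mul hJ0.le]; ring_nf
    _ ≤ _ := Real.rpow_le_rpow (by positivity) h hs.le

theorem le_inv_wIso_sq {d : ℕ} (hd : 0 < d) {s : ℝ} (hs : 0 < s) (k : ZLat d) {R : ℝ}
    (hR : (11 : ℝ) ^ d * Real.exp ((d : ℝ) / 2) ≤ R)
    (hRk : ({l : ZLat d | latSqNorm l < latSqNorm k}.ncard : ℝ) ≤ R) :
    (4 * (1 / (Real.exp 1 * (d + 2)))) ^ s * R ^ (-(2 * s / d)) ≤ ((wIso d s 2 k)⁻¹) ^ 2 := by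
  have hd' : (0 : ℝ) < d := by exact_mod_cast hd
  have hR0 : 0 < R := lt_of_lt_of_le (by positivity) hR
  set y := R ^ (1 / (d : ℝ)) with hy
  have hy0 : 0 < y := by positivity
  have hyd : y ^ d = R := by
    rw [hy, ← Real.rpow_mul_natCast hR0.le, one_div_mul_cancel hd'.ne', Real.rpow_one]
  have hy11 : 11 ≤ y := by
    refine le_of_pow_le_pow_left₀ hd.ne' hy0.le ?_
    rw [hyd]
    refine le_trans ?_ hR
    exact le_mul_of_one_le_right (by positivity) (Real.one_le_exp (by positivity))
  set h := latSqNorm k with hh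
  obtain ⟨m, hm1, hm2⟩ : ∃ m : ℕ, (h : ℝ) ≤ d * ((m : ℝ) + 1) ^ 2 ∧ 2 * (m : ℝ) + 1 ≤ y := by
    rcases Nat.eq_zero_or_pos h with h0 | h0
    · exact ⟨0, by rw [h0]; simp, by simp; linarith⟩
    · refine ⟨Nat.sqrt ((h - 1) / d), ?_, ?_⟩
      · have h1 := Nat.lt_succ_sqrt' ((h - 1) / d)
        rw [Nat.div_lt_iff_lt_mul hd, mul_comm] at h1
        have h2 : h ≤ d * (Nat.sqrt ((h - 1) / d) + 1) ^ 2 := by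
          simp only [Nat.succ_eq_add_one] at h1
          omega
        exact_mod_cast h2
      · have h1 := Nat.sqrt_le' ((h - 1) / d)
        have h2 : d * Nat.sqrt ((h - 1) / d) ^ 2 < h := by
          have := Nat.mul_le_mul_left d h1
          have := Nat.mul_div_le (h - 1) d
          omega
        have h3 := pow_le_ncard_latSqNorm_lt h2
        refine le_of_pow_le_pow_left₀ hd.ne' hy0.le ?_
        rw [hyd]
        refine le_trans ?_ hRk
        exact_mod_cast h3
  have hmain : 4 * (1 + (h : ℝ)) ≤ Real.exp 1 * (d + 2) * y ^ 2 := by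
    have he : 2 ≤ Real.exp 1 := by linarith [Real.exp_one_gt_d9]
    have h1 : 4 * (h : ℝ) ≤ d * (y + 1) ^ 2 := by
      have : ((m : ℝ) + 1) ≤ (y + 1) / 2 := by linarith
      calc 4 * (h : ℝ) ≤ 4 * (d * ((m : ℝ) + 1) ^ 2) := by linarith
        _ ≤ 4 * (d * ((y + 1) / 2) ^ 2) := by gcongr
        _ = _ := by ring
    have h2 : (y + 1) ^ 2 ≤ 2 * y ^ 2 := by nlinarith
    have h3 : d * (y + 1) ^ 2 ≤ d * (2 * y ^ 2) := by gcongr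
    have h4 : 2 * ((d + 2) * y ^ 2) ≤ Real.exp 1 * ((d + 2) * y ^ 2) := by gcongr
    nlinarith
  have hR2 : R ^ (-(2 * s / d)) = (y ^ 2) ^ (-s) := by
    rw [← Real.rpow_natCast, ← Real.rpow_mul hy0.le, hy, ← Real.rpow_mul hR0.le]
    congr 1
    push_cast
    ring
  rw [inv_wIso_two_sq, hR2, Real.rpow_neg (by positivity), Real.rpow_neg (by positivity),
    ← div_eq_mul_inv, div_le_iff₀ (by positivity), ← div_eq_inv_mul, le_div_iff₀ (by positivity),
    ← Real.mul_rpow (by positivity) (by positivity)]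
  refine Real.rpow_le_rpow (by positivity) ?_ hs.le
  rw [mul_one_div, div_mul_eq_mul_div, div_le_iff₀ (by positivity)]
  linarith

theorem rpow_one_sub_tangent {p x y : ℝ} (hp : 1 < p) (hx : 0 < x) (hy : 0 < y) :
    x ^ (1 - p) + (p - 1) * x ^ (-p) * (x - y) ≤ y ^ (1 - p) := by
  have h1 : 1 + (p - 1) * (1 - y / x) ≤ (y / x) ^ (1 - p) := by
    rw [Real.rpow_def_of_pos (by positivity)]
    have h2 := Real.add_one_le_exp (Real.log (y / x) * (1 - p))
    have h3 := Real.log_le_sub_one_of_pos (show 0 < y / x by positivity)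
    nlinarith
  have hx1 : x ^ (1 - p) = x ^ (-p) * x := by
    rw [sub_eq_neg_add, Real.rpow_add_one hx.ne']
  rw [Real.div_rpow hy.le hx.le, le_div_iff₀ (by positivity)] at h1
  refine le_trans (le_of_eq ?_) h1
  rw [hx1]
  field_simp

theorem sum_rpow_tail_le {p : ℝ} (hp : 1 < p) {n M : ℕ} (hn : 0 < n) (hM : n ≤ M) :
    ∑ j ∈ Finset.Ico n M, ((j : ℝ) + 1) ^ (-p) ≤ (n : ℝ) ^ (1 - p) / (p - 1) := by
  have hp1 : 0 < p - 1 := by linarith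
  have key : ∑ j ∈ Finset.Ico n M, ((j : ℝ) + 1) ^ (-p) ≤
      ((n : ℝ) ^ (1 - p) - (M : ℝ) ^ (1 - p)) / (p - 1) := by
    induction M, hM using Nat.le_induction with
    | base => simp
    | succ M hM ih =>
      rw [Finset.sum_Ico_succ_top hM]
      have hM0 : (0 : ℝ) < M := by exact_mod_cast hn.trans_le hM
      have h := rpow_one_sub_tangent hp (show (0 : ℝ) < M + 1 by positivity) hM0
      rw [le_div_iff₀ hp1] at ih ⊢
      push_cast
      linarith
  refine key.trans ?_
  gcongr
  linarith [Real.rpow_nonneg (Nat.cast_nonneg (α := ℝ) M) (1 - p)]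

theorem le_sum_rpow_tail {p : ℝ} (hp : 1 < p) {n M : ℕ} (hn : 0 < n) (hM : n ≤ M) :
    ((n : ℝ) ^ (1 - p) - (M : ℝ) ^ (1 - p)) / (p - 1) ≤
      ∑ j ∈ Finset.Ico n M, (j : ℝ) ^ (-p) := by
  have hp1 : 0 < p - 1 := by linarith
  induction M, hM using Nat.le_induction with
  | base => simp
  | succ M hM ih =>
    rw [Finset.sum_Ico_succ_top hM]
    have hM0 : (0 : ℝ) < M := by exact_mod_cast hn.trans_le hM
    have h := rpow_one_sub_tangent hp hM0 (show (0 : ℝ) < M + 1 by positivity)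
    rw [div_le_iff₀ hp1] at ih ⊢
    push_cast
    linarith
theorem torusMeasure_eq_pi (d : ℕ) :
    torusMeasure d = Measure.pi fun _ : Fin d => AddCircle.haarAddCircle (T := 2 * Real.pi) := by
  refine (Measure.pi_eq fun s _ => ?_).symm
  have h0 : ENNReal.ofReal (2 * Real.pi) ≠ 0 := by simp [Real.pi_pos]
  rw [torusMeasure, Measure.smul_apply, Measure.pi_pi, AddCircle.volume_eq_smul_haarAddCircle]
  simp only [Measure.smul_apply, smul_eq_mul, Finset.prod_mul_distrib, Finset.prod_const,
    Finset.card_univ, Fintype.card_fin]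
  rw [← mul_assoc, ← mul_pow, ENNReal.inv_mul_cancel h0 ENNReal.ofReal_ne_top, one_pow, one_mul]

instance isProbabilityMeasure_torusMeasure (d : ℕ) : IsProbabilityMeasure (torusMeasure d) := by
  rw [torusMeasure_eq_pi]; infer_instance

/-- The characters of the torus, as continuous maps. -/
def torusCharMap {d : ℕ} (k : ZLat d) : C(Torus d, ℂ) where
  toFun := torusChar k
  continuous_toFun := by unfold torusChar; fun_prop

theorem torusCharMap_apply {d : ℕ} (k : ZLat d) (x : Torus d) :
    torusCharMap k x = torusChar k x := rfl

theorem norm_torusChar {d : ℕ} (k : ZLat d) (x : Torus d) : ‖torusChar k x‖ = 1 := by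
  simp only [torusChar, norm_prod, fourier_apply, Circle.norm_coe, Finset.prod_const_one]

theorem torusChar_neg {d : ℕ} (k : ZLat d) (x : Torus d) :
    torusChar (-k) x = (starRingEnd ℂ) (torusChar k x) := by
  simp only [torusChar, map_prod, Pi.neg_apply, fourier_neg]

theorem torusChar_add {d : ℕ} (k l : ZLat d) (x : Torus d) :
    torusChar (k + l) x = torusChar k x * torusChar l x := by
  simp only [torusChar, Pi.add_apply, fourier_add, Finset.prod_mul_distrib]

theorem torusChar_zero {d : ℕ} (x : Torus d) : torusChar (0 : ZLat d) x = 1 := by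
  simp only [torusChar, Pi.zero_apply, fourier_zero, Finset.prod_const_one]

theorem torusChar_single {d : ℕ} (i : Fin d) (x : Torus d) :
    torusChar (Pi.single i 1) x = fourier 1 (x i) := by
  rw [torusChar, Finset.prod_eq_single i]
  · simp
  · intro j _ hj
    rw [Pi.single_eq_of_ne hj, fourier_zero]
  · simp

/-- The star subalgebra of trigonometric polynomials on the torus. -/
def trigPolynomials (d : ℕ) : StarSubalgebra ℂ C(Torus d, ℂ) where
  toSubalgebra := Algebra.adjoin ℂ (Set.range torusCharMap)
  star_mem' := by
    change Algebra.adjoin ℂ (Set.range torusCharMap) ≤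
      star (Algebra.adjoin ℂ (Set.range torusCharMap))
    refine Algebra.adjoin_le ?_
    rintro _ ⟨k, rfl⟩
    refine Algebra.subset_adjoin ⟨-k, ?_⟩
    ext1 x
    simp only [torusCharMap_apply, torusChar_neg, starRingEnd_apply, ContinuousMap.star_apply]

theorem trigPolynomials_coe (d : ℕ) :
    Subalgebra.toSubmodule (trigPolynomials d).toSubalgebra =
      Submodule.span ℂ (Set.range torusCharMap) := by
  apply Algebra.adjoin_eq_span_of_subset
  refine .trans (fun x => Submonoid.closure_induction (fun _ => id) ⟨0, ?_⟩ ?_)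
    Submodule.subset_span
  · ext x
    exact torusChar_zero x
  · rintro _ _ _ _ ⟨k, rfl⟩ ⟨l, rfl⟩
    refine ⟨k + l, ?_⟩
    ext x
    exact torusChar_add k l x

theorem trigPolynomials_separatesPoints (d : ℕ) : (trigPolynomials d).SeparatesPoints := by
  intro x y hxy
  obtain ⟨i, hi⟩ := Function.ne_iff.1 hxy
  refine ⟨_, ⟨torusCharMap (Pi.single i 1), Algebra.subset_adjoin ⟨Pi.single i 1, rfl⟩, rfl⟩, ?_⟩
  simp only [torusCharMap_apply]
  rw [torusChar_single, torusChar_single, fourier_one, fourier_one]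
  exact fun h => hi (AddCircle.injective_toCircle (by positivity) (Circle.ext h))

theorem span_torusCharMap_closure_eq_top (d : ℕ) :
    (Submodule.span ℂ (Set.range (torusCharMap (d := d)))).topologicalClosure = ⊤ := by
  rw [← trigPolynomials_coe]
  exact congr_arg (Subalgebra.toSubmodule <| StarSubalgebra.toSubalgebra ·)
    (ContinuousMap.starSubalgebra_topologicalClosure_eq_top_of_separatesPoints _
      (trigPolynomials_separatesPoints d))

theorem integral_torusChar {d : ℕ} {k : ZLat d} (hk : k ≠ 0) :
    ∫ x, torusChar k x ∂(torusMeasure d) = 0 := by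
  obtain ⟨i, hi⟩ := Function.ne_iff.1 hk
  simp only [torusMeasure_eq_pi, torusChar]
  rw [integral_fintype_prod_eq_prod (f := fun j (y : AddCircle (2 * Real.pi)) => fourier (k j) y)]
  refine Finset.prod_eq_zero (Finset.mem_univ i) ?_
  exact integral_eq_zero_of_add_right_eq_neg (μ := AddCircle.haarAddCircle)
    (fourier_add_half_inv_index hi Real.two_pi_pos)

/-- The characters as elements of `L²`. -/
abbrev torusCharL2 {d : ℕ} (k : ZLat d) : Lp ℂ 2 (torusMeasure d) :=
  ContinuousMap.toLp (E := ℂ) 2 (torusMeasure d) ℂ (torusCharMap k)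

theorem orthonormal_torusCharL2 (d : ℕ) : Orthonormal ℂ (torusCharL2 (d := d)) := by
  rw [orthonormal_iff_ite]
  intro k l
  simp only [ContinuousMap.inner_toLp, torusCharMap_apply, ← torusChar_neg, ← torusChar_add]
  split_ifs with h
  · simp [h, torusChar_zero]
  · exact integral_torusChar (by rwa [← sub_eq_add_neg, sub_ne_zero, ne_comm])

theorem span_torusCharL2_closure_eq_top (d : ℕ) :
    (Submodule.span ℂ (Set.range (torusCharL2 (d := d)))).topologicalClosure = ⊤ := by
  simpa only [Submodule.map_span, ContinuousLinearMap.coe_coe, ← Set.range_comp,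
    Function.comp_def] using
    (ContinuousMap.toLp_denseRange ℂ (torusMeasure d) ℂ
      (by simp : (2 : ℝ≥0∞) ≠ ⊤)).topologicalClosure_map_submodule (span_torusCharMap_closure_eq_top d)

/-- The Fourier basis of `L²(𝕋^d)`. -/
def torusBasis (d : ℕ) : HilbertBasis (ZLat d) ℂ (Lp ℂ 2 (torusMeasure d)) :=
  HilbertBasis.mk (orthonormal_torusCharL2 d) (span_torusCharL2_closure_eq_top d).ge

theorem inner_torusCharL2 {d : ℕ} {g : Torus d → ℂ} (hg : MemLp g 2 (torusMeasure d))
    (k : ZLat d) : inner ℂ (torusCharL2 k) (hg.toLp g) = fourierCoef g k := by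
  rw [L2.inner_def, fourierCoef]
  refine integral_congr_ae ?_
  filter_upwards [ContinuousMap.coeFn_toLp (p := 2) (𝕜 := ℂ) (torusMeasure d) (torusCharMap k),
    hg.coeFn_toLp] with x h1 h2
  rw [h1, h2, RCLike.inner_apply, mul_comm, torusCharMap_apply]

/-- Uniqueness of Fourier coefficients. -/
theorem ae_eq_of_fourierCoef_eq {d : ℕ} {f g : Torus d → ℂ} (hf : MemLp f 2 (torusMeasure d))
    (hg : MemLp g 2 (torusMeasure d)) (h : ∀ k, fourierCoef f k = fourierCoef g k) :
    f =ᵐ[torusMeasure d] g := by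
  rw [← MemLp.toLp_eq_toLp_iff hf hg]
  apply (torusBasis d).repr.injective
  ext k
  simp only [HilbertBasis.repr_apply_apply, torusBasis, HilbertBasis.coe_mk]
  rw [inner_torusCharL2, inner_torusCharL2, h]

/-- Bessel's inequality on the torus. -/
theorem sum_sq_fourierCoef_le {d : ℕ} {g : Torus d → ℂ} (hg : MemLp g 2 (torusMeasure d))
    (K : Finset (ZLat d)) :
    ∑ k ∈ K, ‖fourierCoef g k‖ ^ 2 ≤ ∫ x, ‖g x‖ ^ 2 ∂(torusMeasure d) := by
  have h := (orthonormal_torusCharL2 d).sum_inner_products_le (x := hg.toLp g) (s := K)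
  simp only [inner_torusCharL2] at h
  refine h.trans (le_of_eq ?_)
  rw [← inner_self_eq_norm_sq (𝕜 := ℂ), L2.inner_def]
  have h2 : ∫ x, inner ℂ (hg.toLp g x) (hg.toLp g x) ∂(torusMeasure d) =
      ∫ x, ((‖g x‖ ^ 2 : ℝ) : ℂ) ∂(torusMeasure d) := by
    refine integral_congr_ae ?_
    filter_upwards [hg.coeFn_toLp] with x hx
    rw [hx, inner_self_eq_norm_sq_to_K]
    norm_cast
  rw [h2, integral_complex_ofReal]
  exact RCLike.ofReal_re _

theorem fourierCoef_torusChar {d : ℕ} (k l : ZLat d) :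
    fourierCoef (torusChar k) l = if l = k then 1 else 0 := by
  simp only [fourierCoef, ← torusChar_neg, ← torusChar_add]
  split_ifs with h
  · simp [h, torusChar_zero]
  · exact integral_torusChar (by rwa [neg_add_eq_sub, sub_ne_zero, ne_comm])

theorem memLp_torusChar {d : ℕ} (k : ZLat d) (p : ℝ≥0∞) :
    MemLp (torusChar k) p (torusMeasure d) :=
  MemLp.of_bound (torusCharMap k).continuous.aestronglyMeasurable 1
    (Eventually.of_forall fun x => (norm_torusChar k x).le)

theorem ae_norm_le_norm_Lp_top {α : Type*} {m : MeasurableSpace α} {μ : Measure α}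
    (f : Lp ℂ ⊤ μ) : ∀ᵐ x ∂μ, ‖f x‖ ≤ ‖f‖ := by
  have h := ae_le_eLpNormEssSup (f := f) (μ := μ)
  filter_upwards [h] with x hx
  rw [Lp.norm_def, eLpNorm_exponent_top]
  rw [← eLpNorm_exponent_top] at hx ⊢
  have := ENNReal.toReal_mono (Lp.eLpNorm_ne_top f) hx
  simpa using this

theorem coeFn_sum_smul_Lp {α ι : Type*} {m : MeasurableSpace α} {μ : Measure α} {p : ℝ≥0∞}
    (s : Finset ι) (c : ι → ℂ) (f : ι → Lp ℂ p μ) :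
    ⇑(∑ i ∈ s, c i • f i) =ᵐ[μ] fun x => ∑ i ∈ s, c i * f i x := by
  classical
  induction s using Finset.induction_on with
  | empty =>
    simp only [Finset.sum_empty]
    exact Lp.coeFn_zero ℂ p μ
  | insert a s ha ih =>
    simp only [Finset.sum_insert ha]
    filter_upwards [Lp.coeFn_add (c a • f a) (∑ i ∈ s, c i • f i), Lp.coeFn_smul (c a) (f a), ih]
      with x h1 h2 h3
    rw [h1, Pi.add_apply, h2, h3, Pi.smul_apply, smul_eq_mul]

/-- The pointwise square function of an orthonormal family under an operator into `L_∞` is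
bounded by the operator norm. -/
theorem ae_sum_sq_le_opNorm_sq {α ι X : Type*} [Fintype ι] {m : MeasurableSpace α} {μ : Measure α}
    [NormedAddCommGroup X] [InnerProductSpace ℂ X] (B : X →L[ℂ] Lp ℂ ⊤ μ) {f : ι → X}
    (hf : Orthonormal ℂ f) : ∀ᵐ x ∂μ, ∑ i, ‖B (f i) x‖ ^ 2 ≤ ‖B‖ ^ 2 := by
  have hnorm : ∀ c : ι → ℂ, ‖∑ i, c i • f i‖ = √(∑ i, ‖c i‖ ^ 2) := by
    intro c
    rw [eq_comm, Real.sqrt_eq_iff_mul_self_eq (by positivity) (by positivity), ← pow_two,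
      ← inner_self_eq_norm_sq (𝕜 := ℂ), hf.inner_sum]
    simp [RCLike.conj_mul, ← Complex.ofReal_pow]
  have hc : ∀ c : ι → ℂ, ∀ᵐ x ∂μ, ‖∑ i, c i * B (f i) x‖ ≤ ‖B‖ * √(∑ i, ‖c i‖ ^ 2) := by
    intro c
    filter_upwards [ae_norm_le_norm_Lp_top (∑ i, c i • B (f i)),
      coeFn_sum_smul_Lp Finset.univ c fun i => B (f i)] with x h1 h2
    rw [← h2, ← hnorm c]
    refine h1.trans ?_
    have h3 : ∑ i, c i • B (f i) = B (∑ i, c i • f i) := by simp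
    rw [h3]
    exact B.le_opNorm _
  have hall := ae_all_iff.2 fun n => hc (TopologicalSpace.denseSeq (ι → ℂ) n)
  filter_upwards [hall] with x hx
  have hclosed : IsClosed {c : ι → ℂ | ‖∑ i, c i * B (f i) x‖ ≤ ‖B‖ * √(∑ i, ‖c i‖ ^ 2)} :=
    isClosed_le (by fun_prop) (by fun_prop)
  have hx' : ∀ c : ι → ℂ, ‖∑ i, c i * B (f i) x‖ ≤ ‖B‖ * √(∑ i, ‖c i‖ ^ 2) := fun c =>
    (TopologicalSpace.denseRange_denseSeq (ι → ℂ)).induction_on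
      (p := fun c => ‖∑ i, c i * B (f i) x‖ ≤ ‖B‖ * √(∑ i, ‖c i‖ ^ 2)) c hclosed hx
  have h := hx' fun i => (starRingEnd ℂ) (B (f i) x)
  set S := ∑ i, ‖B (f i) x‖ ^ 2 with hS
  have hS0 : 0 ≤ S := by positivity
  have h1 : ‖∑ i, (starRingEnd ℂ) (B (f i) x) * B (f i) x‖ = S := by
    have : ∑ i, (starRingEnd ℂ) (B (f i) x) * B (f i) x = ((S : ℝ) : ℂ) := by
      simp [hS, RCLike.conj_mul]
    rw [this, Complex.norm_real, Real.norm_of_nonneg hS0]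
  simp only [h1, RCLike.norm_conj] at h
  rw [← hS] at h
  rcases hS0.eq_or_lt with h0 | h0
  · rw [← h0]; positivity
  · have h2 : √S * √S ≤ ‖B‖ * √S := by rwa [Real.mul_self_sqrt hS0]
    have h3 := le_of_mul_le_mul_right h2 (Real.sqrt_pos.2 h0)
    calc S = √S ^ 2 := (Real.sq_sqrt hS0).symm
      _ ≤ ‖B‖ ^ 2 := by gcongr

theorem image_single_ae_eq {d : ℕ} {s : ℝ} {T : ellTwo d →L[ℂ] Lp ℂ ⊤ (torusMeasure d)}
    (hT : ∀ (c : ellTwo d) (k : ZLat d), fourierCoef (⇑(T c)) k = c k / (wIso d s 2 k : ℂ))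
    (k : ZLat d) :
    T (lp.single 2 k 1) =ᵐ[torusMeasure d] fun x => ((wIso d s 2 k : ℂ))⁻¹ * torusChar k x := by
  refine ae_eq_of_fourierCoef_eq ((Lp.memLp _).mono_exponent le_top)
    ((memLp_torusChar k 2).const_mul _) fun l => ?_
  have h : fourierCoef (fun x => ((wIso d s 2 k : ℂ))⁻¹ * torusChar k x) l =
      ((wIso d s 2 k : ℂ))⁻¹ * fourierCoef (torusChar k) l := by
    simp only [fourierCoef, ← integral_const_mul]
    congr 1
    ext x
    ring
  rw [hT, h, fourierCoef_torusChar, lp.single_apply]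
  split_ifs with hkl
  · subst hkl; simp
  · rw [Pi.single_eq_of_ne hkl]; simp

theorem norm_image_single_le {d : ℕ} {s : ℝ} {T : ellTwo d →L[ℂ] Lp ℂ ⊤ (torusMeasure d)}
    (hT : ∀ (c : ellTwo d) (k : ZLat d), fourierCoef (⇑(T c)) k = c k / (wIso d s 2 k : ℂ))
    (k : ZLat d) (z : ℂ) : ‖T (lp.single 2 k z)‖ ≤ ‖z‖ * (wIso d s 2 k)⁻¹ := by
  have hz : lp.single 2 k z = z • (lp.single 2 k (1 : ℂ) : ellTwo d) := by
    rw [← lp.single_smul, smul_eq_mul, mul_one]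
  have hw := wIso_two_pos s k
  rw [hz, map_smul, norm_smul]
  gcongr
  refine (Lp.norm_le_of_ae_bound (C := (wIso d s 2 k)⁻¹) (by positivity) ?_).trans (by simp)
  filter_upwards [image_single_ae_eq hT k] with x hx
  rw [hx, norm_mul, norm_torusChar, mul_one, norm_inv, Complex.norm_real,
    Real.norm_of_nonneg hw.le]

theorem sum_sq_le_norm_sq {d : ℕ} (c : ellTwo d) (F : Finset (ZLat d)) :
    ∑ k ∈ F, ‖c k‖ ^ 2 ≤ ‖c‖ ^ 2 := by
  have h := lp.sum_rpow_le_norm_rpow (p := 2) (by norm_num) c F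
  simpa using h

theorem approxNum_succ_le {d : ℕ} {s : ℝ} {T : ellTwo d →L[ℂ] Lp ℂ ⊤ (torusMeasure d)}
    (hT : ∀ (c : ellTwo d) (k : ZLat d), fourierCoef (⇑(T c)) k = c k / (wIso d s 2 k : ℂ))
    {n : ℕ} {S : Finset (ZLat d)} (hS : S.card ≤ n) {E : ℝ} (hE : 0 ≤ E)
    (hF : ∀ F : Finset (ZLat d), Disjoint F S → ∑ k ∈ F, ((wIso d s 2 k)⁻¹) ^ 2 ≤ E ^ 2) :
    approxNum T (n + 1) ≤ E := by
  classical
  let e : ZLat d → ellTwo d := fun k => lp.single 2 k 1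
  let A : ellTwo d →L[ℂ] Lp ℂ ⊤ (torusMeasure d) :=
    ∑ k ∈ S, (innerSL ℂ (e k)).smulRight (T (e k))
  have hA : ∀ c, A c = ∑ k ∈ S, T (lp.single 2 k (c k)) := by
    intro c
    simp only [A, sum_apply, ContinuousLinearMap.smulRight_apply]
    refine Finset.sum_congr rfl fun k _ => ?_
    have h1 : innerSL ℂ (e k) c = c k := by
      rw [innerSL_apply_apply, lp.inner_single_left]
      simp
    rw [h1, ← map_smul, ← lp.single_smul, smul_eq_mul, mul_one]
  refine le_trans (csInf_le ⟨0, ?_⟩ ⟨A, ?_, rfl⟩) ?_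
  · rintro _ ⟨B, _, rfl⟩
    exact norm_nonneg _
  · have hle : LinearMap.range (A : ellTwo d →ₗ[ℂ] Lp ℂ ⊤ (torusMeasure d)) ≤
        Submodule.span ℂ (S.image fun k => T (e k) : Finset _) := by
      rintro _ ⟨c, rfl⟩
      change A c ∈ _
      simp only [A, sum_apply, ContinuousLinearMap.smulRight_apply]
      refine Submodule.sum_mem _ fun k hk => Submodule.smul_mem _ _ (Submodule.subset_span ?_)
      exact Finset.mem_coe.2 (Finset.mem_image_of_mem (fun k => T (e k)) hk)
    refine lt_of_le_of_lt ((Submodule.rank_mono hle).trans (rank_span_finset_le _)) ?_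
    exact_mod_cast Nat.lt_succ_of_le (Finset.card_image_le.trans hS)
  · refine ContinuousLinearMap.opNorm_le_bound _ hE fun c => ?_
    have hsum : HasSum (fun k => T (lp.single 2 k (c k))) (T c) :=
      (lp.hasSum_single (by simp) c).mapL T
    have hlim : Tendsto (fun F : Finset (ZLat d) =>
        ‖∑ k ∈ F, T (lp.single 2 k (c k)) - A c‖) atTop (nhds ‖T c - A c‖) :=
      (hsum.sub_const (A c)).norm
    rw [sub_apply]
    refine le_of_tendsto hlim ?_
    filter_upwards [eventually_ge_atTop S] with F hFS
    rw [hA, ← Finset.sum_sdiff hFS, add_sub_cancel_right]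
    calc ‖∑ k ∈ F \ S, T (lp.single 2 k (c k))‖
        ≤ ∑ k ∈ F \ S, ‖c k‖ * (wIso d s 2 k)⁻¹ :=
          norm_sum_le_of_le _ fun k _ => norm_image_single_le hT k (c k)
      _ ≤ √(∑ k ∈ F \ S, ‖c k‖ ^ 2) * √(∑ k ∈ F \ S, ((wIso d s 2 k)⁻¹) ^ 2) :=
          Real.sum_mul_le_sqrt_mul_sqrt _ _ _
      _ ≤ ‖c‖ * E := by
          gcongr
          · exact Real.sqrt_le_iff.2 ⟨norm_nonneg _, sum_sq_le_norm_sq c _⟩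
          · exact Real.sqrt_le_iff.2 ⟨hE, hF _ Finset.sdiff_disjoint⟩
      _ = E * ‖c‖ := mul_comm _ _

theorem exists_weights_of_rank_lt {d : ℕ} {s : ℝ} {T A : ellTwo d →L[ℂ] Lp ℂ ⊤ (torusMeasure d)}
    (hT : ∀ (c : ellTwo d) (k : ZLat d), fourierCoef (⇑(T c)) k = c k / (wIso d s 2 k : ℂ))
    {n : ℕ} (hA : Module.rank ℂ (LinearMap.range (A : ellTwo d →ₗ[ℂ] Lp ℂ ⊤ (torusMeasure d))) < n)
    (K : Finset (ZLat d)) :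
    ∃ p : ZLat d → ℝ, (∀ k, 0 ≤ p k) ∧ (∀ k, p k ≤ 1) ∧ (K.card : ℝ) + 1 ≤ n + ∑ k ∈ K, p k ∧
      ∑ k ∈ K, ((wIso d s 2 k)⁻¹) ^ 2 * p k ≤ ‖T - A‖ ^ 2 := by
  classical
  let e : ZLat d → ellTwo d := fun k => lp.single 2 k 1
  have he : Orthonormal ℂ e := by
    rw [orthonormal_iff_ite]
    intro k l
    rw [lp.inner_single_left, lp.single_apply]
    split_ifs with h
    · subst h; simp
    · rw [Pi.single_eq_of_ne h]; simp
  let W : Submodule ℂ (ellTwo d) := Submodule.span ℂ (Set.range fun k : K => e k)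
  have heK : Orthonormal ℂ fun k : K => e k := he.comp _ Subtype.val_injective
  have hWfin : FiniteDimensional ℂ W := FiniteDimensional.span_of_finite ℂ (Set.finite_range _)
  have hWdim : Module.finrank ℂ W = K.card := by
    rw [finrank_span_eq_card heK.linearIndependent, Fintype.card_coe]
  have hWzero : ∀ f ∈ W, ∀ k ∉ K, f k = 0 := by
    intro f hf k hk
    induction hf using Submodule.span_induction with
    | mem x hx =>
      obtain ⟨l, rfl⟩ := hx
      exact lp.single_apply_ne 2 _ _ (fun h => hk (by rw [h]; exact l.2))
    | zero => simp
    | add x y _ _ hx hy => rw [lp.coeFn_add, Pi.add_apply, hx, hy, add_zero]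
    | smul a x _ hx => rw [lp.coeFn_smul, Pi.smul_apply, hx, smul_zero]
  let AW : W →ₗ[ℂ] Lp ℂ ⊤ (torusMeasure d) :=
    (A : ellTwo d →ₗ[ℂ] Lp ℂ ⊤ (torusMeasure d)).domRestrict W
  have hker : K.card + 1 ≤ n + Module.finrank ℂ (LinearMap.ker AW) := by
    have h1 := LinearMap.finrank_range_add_finrank_ker AW
    have h2 : Module.finrank ℂ (LinearMap.range AW) < n := by
      have hle : LinearMap.range AW ≤
          LinearMap.range (A : ellTwo d →ₗ[ℂ] Lp ℂ ⊤ (torusMeasure d)) := by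
        rintro _ ⟨x, rfl⟩
        exact ⟨x, rfl⟩
      have h3 := (Submodule.rank_mono hle).trans_lt hA
      rw [← Module.finrank_eq_rank] at h3
      exact_mod_cast h3
    omega
  let b := stdOrthonormalBasis ℂ (LinearMap.ker AW)
  let f : Fin (Module.finrank ℂ (LinearMap.ker AW)) → ellTwo d := fun i => ((b i : W) : ellTwo d)
  have hf : Orthonormal ℂ f :=
    (b.orthonormal.comp_linearIsometry (LinearMap.ker AW).subtypeₗᵢ).comp_linearIsometry
      W.subtypeₗᵢ
  have hfW : ∀ i, f i ∈ W := fun i => (b i : W).2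
  have hAf : ∀ i, A (f i) = 0 := fun i => LinearMap.mem_ker.1 (b i).2
  refine ⟨fun k => ∑ i, ‖f i k‖ ^ 2, fun k => by positivity, fun k => ?_, ?_, ?_⟩
  · have h := hf.sum_inner_products_le (x := e k) (s := Finset.univ)
    have he1 : ‖e k‖ = 1 := he.1 k
    rw [he1] at h
    simpa [e, lp.inner_single_right] using h
  · have h1 : ∀ i, ∑ k ∈ K, ‖f i k‖ ^ 2 = 1 := by
      intro i
      have h2 : ‖f i‖ ^ 2 = ∑' k, ‖f i k‖ ^ 2 := by
        simpa using lp.norm_rpow_eq_tsum (p := 2) (by norm_num) (f i)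
      rw [hf.1 i, one_pow, tsum_eq_sum (s := K)] at h2
      · exact h2.symm
      · intro k hk
        rw [hWzero _ (hfW i) k hk]
        simp
    rw [Finset.sum_comm]
    simp only [h1, Finset.sum_const, Finset.card_univ, Fintype.card_fin, nsmul_eq_mul, mul_one]
    exact_mod_cast hker
  · have hmem : ∀ i, MemLp (T (f i)) 2 (torusMeasure d) := fun i =>
      (Lp.memLp _).mono_exponent le_top
    have hint : ∀ i, Integrable (fun x => ‖T (f i) x‖ ^ 2) (torusMeasure d) := fun i =>
      (hmem i).integrable_norm_pow two_ne_zero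
    have hae := ae_sum_sq_le_opNorm_sq (T - A) hf
    simp only [sub_apply, hAf, sub_zero] at hae
    calc ∑ k ∈ K, ((wIso d s 2 k)⁻¹) ^ 2 * ∑ i, ‖f i k‖ ^ 2
        = ∑ i, ∑ k ∈ K, ‖fourierCoef (T (f i)) k‖ ^ 2 := by
          rw [Finset.sum_comm]
          refine Finset.sum_congr rfl fun k _ => ?_
          rw [Finset.mul_sum]
          refine Finset.sum_congr rfl fun i _ => ?_
          rw [hT, norm_div, Complex.norm_real, Real.norm_of_nonneg (wIso_two_pos s k).le,
            div_eq_inv_mul, mul_pow]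
      _ ≤ ∑ i, ∫ x, ‖T (f i) x‖ ^ 2 ∂(torusMeasure d) :=
          Finset.sum_le_sum fun i _ => sum_sq_fourierCoef_le (hmem i) K
      _ = ∫ x, ∑ i, ‖T (f i) x‖ ^ 2 ∂(torusMeasure d) :=
          (integral_finsetSum _ fun i _ => hint i).symm
      _ ≤ ∫ _x, ‖T - A‖ ^ 2 ∂(torusMeasure d) :=
          integral_mono_ae (integrable_finsetSum _ fun i _ => hint i) (integrable_const _) hae
      _ = ‖T - A‖ ^ 2 := by simp

/-- A weighted sum whose weights lie in `[0, 1]` and miss less than `n` units of mass dominates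
the tail from index `n` of an antitone minorant. -/
theorem sum_Ico_le_sum_mul_of_rank {X : Type*} {K : Finset X} {r : X → ℕ} {a p : X → ℝ}
    {τ : ℕ → ℝ} {n : ℕ} (hn : 0 < n) (hr : Function.Injective r) (hrK : ∀ k ∈ K, r k < K.card)
    (hnK : n ≤ K.card) (hτ : ∀ j, n ≤ j → τ j ≤ τ n) (hτ0 : 0 ≤ τ n)
    (ha : ∀ k ∈ K, τ (max (r k + 1) n) ≤ a k) (hp0 : ∀ k, 0 ≤ p k) (hp1 : ∀ k, p k ≤ 1)
    (hp : (K.card : ℝ) + 1 ≤ n + ∑ k ∈ K, p k) :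
    ∑ j ∈ Finset.Ico n (K.card + 1), τ j ≤ ∑ k ∈ K, a k * p k := by
  classical
  have himg : K.image r = Finset.range K.card :=
    Finset.eq_of_subset_of_card_le
      (fun j hj => by
        obtain ⟨k, hk, rfl⟩ := Finset.mem_image.1 hj
        exact Finset.mem_range.2 (hrK k hk))
      (by rw [Finset.card_range, Finset.card_image_of_injective _ hr])
  have hterm : ∀ k ∈ K, τ (max (r k + 1) n) - τ n * (1 - p k) ≤ a k * p k := by
    intro k hk
    have h1 := hτ _ (le_max_right (r k + 1) n)
    have h2 := mul_le_mul_of_nonneg_right (ha k hk) (hp0 k)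
    have h3 := mul_le_mul_of_nonneg_right h1 (sub_nonneg.2 (hp1 k))
    linarith
  have hsum : ∑ k ∈ K, τ (max (r k + 1) n) =
      ((n : ℝ) - 1) * τ n + ∑ j ∈ Finset.Ico n (K.card + 1), τ j := by
    calc ∑ k ∈ K, τ (max (r k + 1) n) = ∑ j ∈ Finset.range K.card, τ (max (j + 1) n) := by
          rw [← himg, Finset.sum_image hr.injOn]
      _ = ∑ j ∈ Finset.range (n - 1), τ (max (j + 1) n) +
            ∑ j ∈ Finset.Ico (n - 1) K.card, τ (max (j + 1) n) :=
          (Finset.sum_range_add_sum_Ico _ (by omega)).symm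
      _ = _ := by
          congr 1
          · rw [Finset.sum_congr rfl (g := fun _ => τ n)
              fun j hj => by rw [max_eq_right (by have := Finset.mem_range.1 hj; omega)]]
            rw [Finset.sum_const, Finset.card_range, nsmul_eq_mul, Nat.cast_pred hn]
          · rw [Finset.sum_congr rfl (g := fun j => τ (j + 1))
              fun j hj => by rw [max_eq_left (by have := Finset.mem_Ico.1 hj; omega)]]
            rw [Finset.sum_Ico_add' τ (n - 1) K.card 1, Nat.sub_add_cancel hn]
  have h := Finset.sum_le_sum hterm
  rw [Finset.sum_sub_distrib, ← Finset.mul_sum, hsum, Finset.sum_sub_distrib, Finset.sum_const,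
    nsmul_eq_mul, mul_one] at h
  have h2 := mul_le_mul_of_nonneg_left hp hτ0
  nlinarith

theorem approxNum_succ_le_rpow {d : ℕ} (hd : 0 < d) {s : ℝ} (hs : (d : ℝ) / 2 < s)
    {T : ellTwo d →L[ℂ] Lp ℂ ⊤ (torusMeasure d)}
    (hT : ∀ (c : ellTwo d) (k : ZLat d), fourierCoef (⇑(T c)) k = c k / (wIso d s 2 k : ℂ))
    {n : ℕ} (hn : (9 : ℝ) ^ d * Real.exp ((d : ℝ) / 2) ≤ n) {E : ℝ} (hE0 : 0 ≤ E)
    (hE : (32 * Real.exp 1 / d) ^ s * ((n : ℝ) ^ (1 - 2 * s / d) / (2 * s / d - 1)) ≤ E ^ 2) :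
    approxNum T (n + 1) ≤ E := by
  classical
  have hd' : (0 : ℝ) < d := by exact_mod_cast hd
  have hs0 : 0 < s := by linarith [half_pos hd']
  have hp : 1 < 2 * s / d := by rw [lt_div_iff₀ hd']; linarith
  have hn0 : 0 < n := by
    have h : (0 : ℝ) < n := lt_of_lt_of_le (by positivity) hn
    exact_mod_cast h
  obtain ⟨r, hr, hr'⟩ := exists_injective_rank (latSqNorm (d := d)) (finite_latSqNorm_le d)
  have hfin : (r ⁻¹' Set.Iio n).Finite := Set.Finite.preimage hr.injOn (Set.finite_Iio n)
  refine approxNum_succ_le hT (S := hfin.toFinset) ?_ hE0 fun F hF => ?_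
  · exact (Finset.card_le_card_of_injOn r (t := Finset.range n) (fun k hk => by simpa using hk)
      hr.injOn).trans_eq (Finset.card_range n)
  · have hnr : ∀ k ∈ F, n ≤ r k := fun k hk => by
      simpa using Finset.disjoint_left.1 hF hk
    have hsub : F.image r ⊆ Finset.Ico n (n + F.sup r + 1) := by
      intro j hj
      obtain ⟨k, hk, rfl⟩ := Finset.mem_image.1 hj
      have := Finset.le_sup (f := r) hk
      exact Finset.mem_Ico.2 ⟨hnr k hk, by omega⟩
    calc ∑ k ∈ F, ((wIso d s 2 k)⁻¹) ^ 2
        ≤ ∑ k ∈ F, (32 * Real.exp 1 / d) ^ s * ((r k : ℝ) + 1) ^ (-(2 * s / d)) := by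
          refine Finset.sum_le_sum fun k hk => inv_wIso_sq_le hd hs0 k (hn.trans ?_) ?_
          · exact_mod_cast (hnr k hk).trans (Nat.le_succ _)
          · exact_mod_cast (hr' k).2
      _ = (32 * Real.exp 1 / d) ^ s * ∑ j ∈ F.image r, ((j : ℝ) + 1) ^ (-(2 * s / d)) := by
          rw [Finset.sum_image hr.injOn, Finset.mul_sum]
      _ ≤ (32 * Real.exp 1 / d) ^ s * ((n : ℝ) ^ (1 - 2 * s / d) / (2 * s / d - 1)) := by
          refine mul_le_mul_of_nonneg_left ?_ (by positivity)
          refine (Finset.sum_le_sum_of_subset_of_nonneg hsub fun j _ _ => by positivity).trans ?_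
          exact sum_rpow_tail_le hp hn0 (by omega)
      _ ≤ E ^ 2 := hE

theorem rpow_div_le_norm_sub_sq {d : ℕ} (hd : 0 < d) {s : ℝ} (hs : (d : ℝ) / 2 < s)
    {T A : ellTwo d →L[ℂ] Lp ℂ ⊤ (torusMeasure d)}
    (hT : ∀ (c : ellTwo d) (k : ZLat d), fourierCoef (⇑(T c)) k = c k / (wIso d s 2 k : ℂ))
    {n : ℕ} (hn : (11 : ℝ) ^ d * Real.exp ((d : ℝ) / 2) ≤ n)
    (hA : Module.rank ℂ (LinearMap.range (A : ellTwo d →ₗ[ℂ] Lp ℂ ⊤ (torusMeasure d))) < n) :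
    (4 * (1 / (Real.exp 1 * (d + 2)))) ^ s * ((n : ℝ) ^ (1 - 2 * s / d) / (2 * s / d - 1)) ≤
      ‖T - A‖ ^ 2 := by
  have hd' : (0 : ℝ) < d := by exact_mod_cast hd
  have hs0 : 0 < s := by linarith [half_pos hd']
  have hp : 1 < 2 * s / d := by rw [lt_div_iff₀ hd']; linarith
  have hn0 : 0 < n := by
    have h : (0 : ℝ) < n := lt_of_lt_of_le (by positivity) hn
    exact_mod_cast h
  obtain ⟨r, hr, hr'⟩ := exists_injective_rank (latSqNorm (d := d)) (finite_latSqNorm_le d)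
  set p := 2 * s / d with hpdef
  set C : ℝ := (4 * (1 / (Real.exp 1 * (d + 2)))) ^ s with hC
  have hC0 : 0 ≤ C := by positivity
  have hbound : ∀ M : ℕ, n ≤ M →
      C * (((n : ℝ) ^ (1 - p) - (M : ℝ) ^ (1 - p)) / (p - 1)) ≤ ‖T - A‖ ^ 2 := by
    intro M hM
    have hfin := finite_latSqNorm_le d (d * M ^ 2)
    set K := hfin.toFinset with hK
    have hKcard : {k : ZLat d | latSqNorm k ≤ d * M ^ 2}.ncard = K.card :=
      Set.ncard_eq_toFinset_card _ hfin
    have hMK : M ≤ K.card := by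
      have h := pow_le_ncard_latSqNorm_lt (Nat.lt_succ_self (d * M ^ 2))
      simp only [Nat.lt_succ_iff, hKcard] at h
      have h1 : 2 * M + 1 ≤ (2 * M + 1) ^ d := Nat.le_self_pow hd.ne' _
      omega
    obtain ⟨q, hq0, hq1, hqs, hqn⟩ := exists_weights_of_rank_lt hT hA K
    have hsum : ∑ j ∈ Finset.Ico n (K.card + 1), C * (j : ℝ) ^ (-p) ≤
        ∑ k ∈ K, ((wIso d s 2 k)⁻¹) ^ 2 * q k := by
      refine sum_Ico_le_sum_mul_of_rank (τ := fun j : ℕ => C * (j : ℝ) ^ (-p)) hn0 hr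
        (fun k hk => ?_) (hM.trans hMK) (fun j hj => ?_) (by positivity) (fun k hk => ?_)
        hq0 hq1 hqs
      · rw [← hKcard]
        refine (hr' k).2.trans_le (Set.ncard_le_ncard (fun l hl => ?_) hfin)
        have h1 : latSqNorm l ≤ latSqNorm k := hl
        have h2 : latSqNorm k ≤ d * M ^ 2 := by simpa [hK] using hk
        exact h1.trans h2
      · refine mul_le_mul_of_nonneg_left ?_ hC0
        exact Real.rpow_le_rpow_of_nonpos (by exact_mod_cast hn0) (by exact_mod_cast hj)
          (by linarith)
      · refine le_inv_wIso_sq hd hs0 k (hn.trans ?_) ?_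
        · exact_mod_cast le_max_right _ _
        · exact_mod_cast ((hr' k).1.trans (Nat.le_succ _)).trans (le_max_left _ _)
    have htail := le_sum_rpow_tail hp hn0 (hM.trans (hMK.trans (Nat.le_succ _)))
    have hmono : ((K.card + 1 : ℕ) : ℝ) ^ (1 - p) ≤ (M : ℝ) ^ (1 - p) :=
      Real.rpow_le_rpow_of_nonpos (by exact_mod_cast hn0.trans_le hM)
        (by exact_mod_cast hMK.trans (Nat.le_succ _)) (by linarith)
    have hp1 : 0 ≤ p - 1 := by linarith
    rw [← Finset.mul_sum] at hsum
    refine le_trans (mul_le_mul_of_nonneg_left (le_trans ?_ htail) hC0) (hsum.trans hqn)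
    gcongr
  have hlim : Tendsto (fun M : ℕ => C * (((n : ℝ) ^ (1 - p) - (M : ℝ) ^ (1 - p)) / (p - 1))) atTop
      (nhds (C * (((n : ℝ) ^ (1 - p) - 0) / (p - 1)))) := by
    have h := (tendsto_rpow_neg_atTop (show 0 < p - 1 by linarith)).comp
      (tendsto_natCast_atTop_atTop (R := ℝ))
    simp only [neg_sub] at h
    exact ((tendsto_const_nhds.sub h).div_const _).const_mul _
  rw [sub_zero] at hlim
  exact le_of_tendsto hlim (eventually_atTop.2 ⟨n, hbound⟩)

theorem sq_sqrt_mul_rpow_mul_rpow {x y z s d : ℝ} (hx : 0 ≤ x) (hy : 0 ≤ y) (hz : 0 ≤ z) :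
    (√x * y ^ (s / 2) * z ^ (1 / 2 - s / d)) ^ 2 = x * y ^ s * z ^ (1 - 2 * s / d) := by
  rw [mul_pow, mul_pow, Real.sq_sqrt hx, ← Real.rpow_mul_natCast hy, ← Real.rpow_mul_natCast hz]
  congr 2
  · congr 1; push_cast; ring
  · push_cast; ring

/-- Corollary 1 of Cobos–Kühn–Sickel. For `d ∈ ℕ` and `s > d/2`,
`a_{n+1}(I_d : H^{s,2}(𝕋^d) → L_∞(𝕋^d)) ≤ √(2d/(2s-d)) (32e/d)^{s/2} n^{1/2-s/d}`
for `n ≥ 9^d e^{d/2}`, and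
`a_n(I_d : H^{s,2}(𝕋^d) → L_∞(𝕋^d)) ≥ √(4d/(4s-d)) (1/(e(d+2)))^{s/2} n^{1/2-s/d}`
for `n ≥ 11^d e^{d/2}`. -/
theorem statement8 (d : ℕ) (hd : 0 < d) (s : ℝ) (hs : (d : ℝ) / 2 < s)
    (T : ellTwo d →L[ℂ] Lp ℂ ⊤ (torusMeasure d))
    (hT : ∀ (c : ellTwo d) (k : ZLat d), fourierCoef (⇑(T c)) k = c k / (wIso d s 2 k : ℂ)) :
    (∀ n : ℕ, (9 : ℝ) ^ d * Real.exp ((d : ℝ) / 2) ≤ (n : ℝ) →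
      approxNum T (n + 1) ≤
        Real.sqrt (2 * (d : ℝ) / (2 * s - d)) * (32 * Real.exp 1 / (d : ℝ)) ^ (s / 2) *
          (n : ℝ) ^ ((1 : ℝ) / 2 - s / (d : ℝ))) ∧
    (∀ n : ℕ, (11 : ℝ) ^ d * Real.exp ((d : ℝ) / 2) ≤ (n : ℝ) →
      Real.sqrt (4 * (d : ℝ) / (4 * s - d)) * (1 / (Real.exp 1 * ((d : ℝ) + 2))) ^ (s / 2) *
          (n : ℝ) ^ ((1 : ℝ) / 2 - s / (d : ℝ)) ≤
        approxNum T n) := by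
  have hd1 : (1 : ℝ) ≤ d := by exact_mod_cast hd
  have hd' : (0 : ℝ) < d := by linarith
  have hs2 : 0 < 2 * s - d := by linarith
  refine ⟨fun n hn => approxNum_succ_le_rpow hd hs hT hn (by positivity) ?_, fun n hn => ?_⟩
  · rw [sq_sqrt_mul_rpow_mul_rpow (by positivity) (by positivity) (by positivity)]
    calc (32 * Real.exp 1 / d) ^ s * ((n : ℝ) ^ (1 - 2 * s / d) / (2 * s / d - 1))
        = d / (2 * s - d) * ((32 * Real.exp 1 / d) ^ s * (n : ℝ) ^ (1 - 2 * s / d)) := by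
          field_simp
      _ ≤ 2 * d / (2 * s - d) * ((32 * Real.exp 1 / d) ^ s * (n : ℝ) ^ (1 - 2 * s / d)) := by
          gcongr; linarith
      _ = _ := by ring
  · have hn0 : 0 < n := by
      have h : (0 : ℝ) < n := lt_of_lt_of_le (by positivity) hn
      exact_mod_cast h
    refine le_csInf ⟨_, 0, by simpa using hn0, rfl⟩ ?_
    rintro _ ⟨A, hA, rfl⟩
    refine (sq_le_sq₀ (by positivity) (norm_nonneg _)).1 ?_
    refine le_trans ?_ (rpow_div_le_norm_sub_sq hd hs hT hn hA)
    have h4s : 0 < 4 * s - d := by linarith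
    rw [sq_sqrt_mul_rpow_mul_rpow (by positivity) (by positivity) (by positivity),
      Real.mul_rpow (by norm_num) (by positivity)]
    have h4 : (2 : ℝ) ≤ 4 ^ s := by
      calc (2 : ℝ) = 4 ^ (1 / 2 : ℝ) := by
            rw [show (4 : ℝ) = 2 ^ (2 : ℝ) by norm_num, ← Real.rpow_mul (by norm_num)]; norm_num
        _ ≤ 4 ^ s := Real.rpow_le_rpow_of_exponent_le (by norm_num) (by linarith)
    have hcoef : 4 * (d : ℝ) / (4 * s - d) ≤ 4 ^ s * (d / (2 * s - d)) := by
      calc 4 * (d : ℝ) / (4 * s - d) ≤ 2 * (d / (2 * s - d)) := by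
            rw [← mul_div_assoc, div_le_div_iff₀ h4s hs2]; nlinarith
        _ ≤ _ := by gcongr
    calc 4 * (d : ℝ) / (4 * s - d) * (1 / (Real.exp 1 * (d + 2))) ^ s *
          (n : ℝ) ^ (1 - 2 * s / d)
        ≤ 4 ^ s * (d / (2 * s - d)) * (1 / (Real.exp 1 * (d + 2))) ^ s *
          (n : ℝ) ^ (1 - 2 * s / d) := by gcongr
      _ = _ := by field_simp
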